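/- Fix κ > 0 and a probability measure G on ℝ with G((−∞,0]) = 0 and G((δ,∞)) > 0 for some δ > 0; for s ≥ 0 let μ_s := cp(κs, G). Fix η₁, η₂, q ∈ ℝ with c := ∫ e^{−η₂ y} dG(y) < ∞. For s > 0 and x, y ∈ ℝ define N(s,x,y) := e^{−η₁}·μ_s({z : z < q − x − y}) + e^{−η₂(x+y−q)}·∫ e^{−η₂ z}·1_{\{z ≥ q−x−y\}} dμ_s(z), H(s,x,y) := N(s,x,y)/N(s,x,0), and the stressed intensity κ*(s,x) := κ·∫ H(s,x,y) dG(y). Then: (i) if x > q, then κ*(s,x) = κ·c for all s > 0; (ii) if x < q, then lim_{s→0⁺} κ*(s,x) = κ·( G({y : y < q − x}) + e^{η₁ − η₂(x−q)}·∫ e^{−η₂ y}·1_{\{y ≥ q−x\}} dG(y) ). -/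

import Mathlib

open MeasureTheory Real Filter Topology

/-- `n`-fold convolution power of a measure on `ℝ` (`G^⋆0 = δ₀`). -/
noncomputable def convPow (G : Measure ℝ) : ℕ → Measure ℝ
  | 0 => Measure.dirac 0
  | n + 1 => (convPow G n).conv G

/-- The compound Poisson distribution `cp(λ, G) = ∑ₙ e^{-λ} λⁿ/n! • G^⋆n`. -/
noncomputable def cp (lam : ℝ) (G : Measure ℝ) : Measure ℝ :=
  Measure.sum fun n => (ENNReal.ofReal (exp (-lam) * lam ^ n / n.factorial)) • convPow G n

instance isProbabilityMeasure_convPow (G : Measure ℝ) [IsProbabilityMeasure G] (n : ℕ) :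
    IsProbabilityMeasure (convPow G n) := by
  induction n with
  | zero => simp only [convPow]; infer_instance
  | succ n ih => simp only [convPow]; infer_instance

lemma convPow_Iio_zero (G : Measure ℝ) [IsProbabilityMeasure G] (hG : G (Set.Iic 0) = 0) (n : ℕ) :
    convPow G n (Set.Iio 0) = 0 := by
  induction n with
  | zero => simp [convPow]
  | succ n ih =>
    have h1 : ∀ᵐ x ∂(convPow G n), 0 ≤ x := by
      rw [ae_iff]; simpa [Set.Iio] using ih
    have h2 : ∀ᵐ y ∂G, 0 ≤ y := by
      rw [ae_iff]
      refine measure_mono_null (fun y hy => ?_) hG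
      simp only [Set.mem_ofPred_eq, not_le] at hy
      exact hy.le
    rw [convPow, ← lintegral_indicator_one measurableSet_Iio,
      Measure.lintegral_conv (measurable_one.indicator measurableSet_Iio)]
    rw [lintegral_congr_ae (g := fun _ => 0), lintegral_zero]
    filter_upwards [h1] with x hx
    rw [lintegral_congr_ae (g := fun _ => 0), lintegral_zero]
    filter_upwards [h2] with y hy
    exact Set.indicator_of_notMem (by simp only [Set.mem_Iio, not_lt]; positivity) _

lemma lintegral_exp_convPow (G : Measure ℝ) [IsProbabilityMeasure G] (η : ℝ)
    (hint : Integrable (fun y => exp (-η * y)) G) (n : ℕ) :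
    ∫⁻ z, ENNReal.ofReal (exp (-η * z)) ∂(convPow G n) =
      ENNReal.ofReal ((∫ y, exp (-η * y) ∂G) ^ n) := by
  induction n with
  | zero => simp [convPow, lintegral_dirac]
  | succ n ih =>
    rw [convPow, Measure.lintegral_conv (by fun_prop)]
    simp only [mul_add, exp_add, ENNReal.ofReal_mul (exp_pos _).le]
    simp_rw [lintegral_const_mul _ (show Measurable fun y : ℝ =>
      ENNReal.ofReal (exp (-η * y)) by fun_prop)]
    rw [lintegral_mul_const _ (by fun_prop), ih, pow_succ,
      ENNReal.ofReal_mul (by positivity),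
      ofReal_integral_eq_lintegral_ofReal hint (ae_of_all _ fun _ => (exp_pos _).le)]

lemma lintegral_exp_cp (G : Measure ℝ) [IsProbabilityMeasure G] (η : ℝ)
    (hint : Integrable (fun y => exp (-η * y)) G) {lam : ℝ} (hlam : 0 ≤ lam) :
    ∫⁻ z, ENNReal.ofReal (exp (-η * z)) ∂(cp lam G) =
      ENNReal.ofReal (exp (lam * ((∫ y, exp (-η * y) ∂G) - 1))) := by
  set c := ∫ y, exp (-η * y) ∂G with hc
  have hc0 : 0 ≤ c := by positivity
  have hs : HasSum (fun n : ℕ => exp (-lam) * lam ^ n / n.factorial * c ^ n)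
      (exp (lam * (c - 1))) := by
    have h := (NormedSpace.expSeries_div_hasSum_exp (lam * c)).mul_left (exp (-lam))
    rw [← Real.exp_eq_exp_ℝ, ← exp_add] at h
    rw [show lam * (c - 1) = -lam + lam * c by ring]
    have hterm (n : ℕ) : exp (-lam) * lam ^ n / n.factorial * c ^ n =
        exp (-lam) * ((lam * c) ^ n / n.factorial) := by
      rw [mul_pow]
      ring
    simpa only [hterm] using h
  rw [cp, lintegral_sum_measure]
  simp_rw [lintegral_smul_measure, lintegral_exp_convPow G η hint, smul_eq_mul, ← hc]
  rw [← hs.tsum_eq, ENNReal.ofReal_tsum_of_nonneg (fun n => by positivity) hs.summable]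
  exact tsum_congr fun n => (ENNReal.ofReal_mul (by positivity)).symm

lemma isProbabilityMeasure_cp (G : Measure ℝ) [IsProbabilityMeasure G] {lam : ℝ}
    (hlam : 0 ≤ lam) : IsProbabilityMeasure (cp lam G) :=
  ⟨by simpa using lintegral_exp_cp G 0 (by simp) hlam⟩

lemma integrable_exp_cp (G : Measure ℝ) [IsProbabilityMeasure G] (η : ℝ)
    (hint : Integrable (fun y => exp (-η * y)) G) {lam : ℝ} (hlam : 0 ≤ lam) :
    Integrable (fun z => exp (-η * z)) (cp lam G) := by
  refine ⟨by fun_prop, ?_⟩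
  rw [hasFiniteIntegral_iff_ofReal (ae_of_all _ fun _ => (exp_pos _).le),
    lintegral_exp_cp G η hint hlam]
  exact ENNReal.ofReal_lt_top

lemma integral_exp_cp (G : Measure ℝ) [IsProbabilityMeasure G] (η : ℝ)
    (hint : Integrable (fun y => exp (-η * y)) G) {lam : ℝ} (hlam : 0 ≤ lam) :
    ∫ z, exp (-η * z) ∂(cp lam G) = exp (lam * ((∫ y, exp (-η * y) ∂G) - 1)) := by
  rw [integral_eq_lintegral_of_nonneg_ae (ae_of_all _ fun _ => (exp_pos _).le) (by fun_prop),
    lintegral_exp_cp G η hint hlam, ENNReal.toReal_ofReal (exp_pos _).le]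

lemma cp_Iio_zero (G : Measure ℝ) [IsProbabilityMeasure G] (hG : G (Set.Iic 0) = 0) (lam : ℝ) :
    cp lam G (Set.Iio 0) = 0 := by
  simp [cp, Measure.sum_apply, convPow_Iio_zero G hG]

lemma exp_neg_le_cp_singleton_zero (G : Measure ℝ) [IsProbabilityMeasure G] {lam : ℝ}
    (hlam : 0 ≤ lam) : exp (-lam) ≤ ((cp lam G) {0}).toReal := by
  have := isProbabilityMeasure_cp G hlam
  rw [← ENNReal.ofReal_le_iff_le_toReal (measure_ne_top _ _), cp,
    Measure.sum_apply _ (measurableSet_singleton 0)]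
  refine le_trans ?_ (ENNReal.le_tsum 0)
  simp [convPow]

lemma integral_exp_truncated_cp_nonneg (G : Measure ℝ) (η lam b : ℝ) :
    0 ≤ ∫ z, exp (-η * z) * (if b ≤ z then (1 : ℝ) else 0) ∂(cp lam G) :=
  integral_nonneg fun z => by dsimp only; split_ifs <;> simp [(exp_pos _).le]

section Truncation

variable (G : Measure ℝ) [IsProbabilityMeasure G] (η : ℝ)

lemma integrable_exp_truncated_cp (hint : Integrable (fun y => exp (-η * y)) G)
    {lam : ℝ} (hlam : 0 ≤ lam) (b : ℝ) :
    Integrable (fun z => exp (-η * z) * (if b ≤ z then (1 : ℝ) else 0)) (cp lam G) := by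
  refine (integrable_exp_cp G η hint hlam).mono' ?_ (ae_of_all _ fun z => ?_)
  · exact ((by fun_prop : Measurable fun z : ℝ => exp (-η * z)).mul
      (Measurable.ite measurableSet_Ici measurable_const measurable_const)).aestronglyMeasurable
  · split_ifs <;> simp [(exp_pos _).le]

lemma integral_exp_truncated_cp_antitone (hint : Integrable (fun y => exp (-η * y)) G)
    {lam : ℝ} (hlam : 0 ≤ lam) :
    Antitone fun b => ∫ z, exp (-η * z) * (if b ≤ z then (1 : ℝ) else 0) ∂(cp lam G) := by
  intro b b' hb
  refine integral_mono (integrable_exp_truncated_cp G η hint hlam b')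
    (integrable_exp_truncated_cp G η hint hlam b) fun z => ?_
  dsimp only
  gcongr
  split_ifs with h1 h2 h2 <;> first | exact le_rfl | exact zero_le_one | exact absurd (hb.trans h1) h2

lemma integral_exp_truncated_cp_le (hint : Integrable (fun y => exp (-η * y)) G)
    {lam : ℝ} (hlam : 0 ≤ lam) (b : ℝ) :
    ∫ z, exp (-η * z) * (if b ≤ z then (1 : ℝ) else 0) ∂(cp lam G) ≤
      exp (lam * ((∫ y, exp (-η * y) ∂G) - 1)) := by
  rw [← integral_exp_cp G η hint hlam]
  refine integral_mono (integrable_exp_truncated_cp G η hint hlam b)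
    (integrable_exp_cp G η hint hlam) fun z => ?_
  dsimp only
  split_ifs <;> simp [(exp_pos _).le]

lemma integral_exp_truncated_cp_of_nonpos (hG : G (Set.Iic 0) = 0)
    (hint : Integrable (fun y => exp (-η * y)) G) {lam : ℝ} (hlam : 0 ≤ lam) {b : ℝ}
    (hb : b ≤ 0) :
    ∫ z, exp (-η * z) * (if b ≤ z then (1 : ℝ) else 0) ∂(cp lam G) =
      exp (lam * ((∫ y, exp (-η * y) ∂G) - 1)) := by
  rw [← integral_exp_cp G η hint hlam]
  refine integral_congr_ae ?_
  have h : ∀ᵐ z ∂(cp lam G), 0 ≤ z := by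
    rw [ae_iff]; simpa [Set.Iio] using cp_Iio_zero G hG lam
  filter_upwards [h] with z hz
  simp [hb.trans hz]

lemma integral_exp_truncated_cp_le_of_pos (hint : Integrable (fun y => exp (-η * y)) G)
    {lam : ℝ} (hlam : 0 ≤ lam) {b : ℝ} (hb : 0 < b) :
    ∫ z, exp (-η * z) * (if b ≤ z then (1 : ℝ) else 0) ∂(cp lam G) ≤
      exp (lam * ((∫ y, exp (-η * y) ∂G) - 1)) - exp (-lam) := by
  have := isProbabilityMeasure_cp G hlam
  have h0 : Integrable (({0} : Set ℝ).indicator (1 : ℝ → ℝ)) (cp lam G) :=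
    (integrable_const (1 : ℝ)).indicator (measurableSet_singleton 0)
  have h1 : ∫ z, ({0} : Set ℝ).indicator (1 : ℝ → ℝ) z ∂(cp lam G) =
      ((cp lam G) {0}).toReal := integral_indicator_one (measurableSet_singleton 0)
  calc _ ≤ ∫ z, (exp (-η * z) - ({0} : Set ℝ).indicator (1 : ℝ → ℝ) z) ∂(cp lam G) := by
        refine integral_mono (integrable_exp_truncated_cp G η hint hlam b)
          ((integrable_exp_cp G η hint hlam).sub h0) fun z => ?_
        by_cases hz : z = 0
        · subst hz; simp [hb.not_ge]
        · simp only [Set.indicator, Set.mem_singleton_iff, hz, if_false, sub_zero]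
          split_ifs <;> simp [(exp_pos _).le]
    _ = exp (lam * ((∫ y, exp (-η * y) ∂G) - 1)) - ((cp lam G) {0}).toReal := by
        rw [integral_sub (integrable_exp_cp G η hint hlam) h0, h1, integral_exp_cp G η hint hlam]
    _ ≤ _ := by gcongr; exact exp_neg_le_cp_singleton_zero G hlam

lemma cp_Iio_of_nonpos (hG : G (Set.Iic 0) = 0) (lam : ℝ) {b : ℝ} (hb : b ≤ 0) :
    ((cp lam G) {z | z < b}).toReal = 0 := by
  have h : cp lam G {z | z < b} = 0 :=
    measure_mono_null (fun z (hz : z < b) => hz.trans_le hb) (cp_Iio_zero G hG lam)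
  rw [h, ENNReal.toReal_zero]

lemma tendsto_mul_const_nhdsGT_zero (κ : ℝ) :
    Tendsto (fun s => κ * s) (𝓝[>] (0 : ℝ)) (𝓝 0) := by
  have : Continuous fun s : ℝ => κ * s := by fun_prop
  simpa using (this.tendsto 0).mono_left nhdsWithin_le_nhds

lemma tendsto_exp_mul_nhds_zero (d : ℝ) : Tendsto (fun l => exp (l * d)) (𝓝 (0 : ℝ)) (𝓝 1) := by
  have : Continuous fun l : ℝ => exp (l * d) := by fun_prop
  simpa using this.tendsto 0

/-- As the intensity tends to zero, the compound Poisson law tends to the Dirac mass at `0` on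
every open lower half-line. -/
lemma tendsto_cp_Iio (hG : G (Set.Iic 0) = 0) (b : ℝ) :
    Tendsto (fun lam => ((cp lam G) {z | z < b}).toReal) (𝓝[≥] (0 : ℝ))
      (𝓝 (if 0 < b then 1 else 0)) := by
  split_ifs with hb
  · have h := (tendsto_exp_mul_nhds_zero (-1)).mono_left (nhdsWithin_le_nhds (s := Set.Ici 0))
    refine tendsto_of_tendsto_of_tendsto_of_le_of_le' h tendsto_const_nhds ?_ ?_
    · filter_upwards [self_mem_nhdsWithin] with lam (hlam : 0 ≤ lam)
      have := isProbabilityMeasure_cp G hlam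
      rw [mul_neg_one]
      refine (exp_neg_le_cp_singleton_zero G hlam).trans ?_
      exact ENNReal.toReal_mono (measure_ne_top _ _) (measure_mono (by simpa using hb))
    · filter_upwards [self_mem_nhdsWithin] with lam (hlam : 0 ≤ lam)
      have := isProbabilityMeasure_cp G hlam
      exact ENNReal.toReal_le_of_le_ofReal zero_le_one (by simpa using prob_le_one)
  · simp_rw [cp_Iio_of_nonpos G hG _ (not_lt.1 hb)]
    exact tendsto_const_nhds

lemma tendsto_integral_exp_truncated_cp (hG : G (Set.Iic 0) = 0)
    (hint : Integrable (fun y => exp (-η * y)) G) (b : ℝ) :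
    Tendsto (fun lam => ∫ z, exp (-η * z) * (if b ≤ z then (1 : ℝ) else 0) ∂(cp lam G))
      (𝓝[≥] (0 : ℝ)) (𝓝 (if 0 < b then 0 else 1)) := by
  have h (d : ℝ) := (tendsto_exp_mul_nhds_zero d).mono_left (nhdsWithin_le_nhds (s := Set.Ici 0))
  split_ifs with hb
  · have h' := (h ((∫ y, exp (-η * y) ∂G) - 1)).sub (h (-1))
    rw [sub_self] at h'
    refine tendsto_of_tendsto_of_tendsto_of_le_of_le' tendsto_const_nhds h'
      (Eventually.of_forall fun lam => integral_exp_truncated_cp_nonneg G η lam b) ?_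
    filter_upwards [self_mem_nhdsWithin] with lam (hlam : 0 ≤ lam)
    rw [mul_neg_one]
    exact integral_exp_truncated_cp_le_of_pos G η hint hlam hb
  · refine (h ((∫ y, exp (-η * y) ∂G) - 1)).congr' ?_
    filter_upwards [self_mem_nhdsWithin] with lam (hlam : 0 ≤ lam)
    exact (integral_exp_truncated_cp_of_nonpos G η hG hint hlam (not_lt.1 hb)).symm

end Truncation

/-- the stressed intensity `κ*(s,x) = κ ∫ H(s,x,y) dG(y)` for the
VaR-and-CVaR kernel `H` equals `κ c` (with `c = ∫ e^{-η₂ y} dG(y)`) for `x > q`, and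
for `x < q` it tends, as `s → 0⁺`, to
`κ (G(-∞, q-x) + e^{η₁ - η₂(x-q)} ∫ e^{-η₂ y} 1_{y ≥ q-x} dG(y))`. -/
theorem stmt_14 (κ : ℝ) (hκ : 0 < κ) (G : Measure ℝ) [IsProbabilityMeasure G]
    (hG : G (Set.Iic 0) = 0) (δ : ℝ) (hδ : 0 < δ) (hGδ : 0 < G (Set.Ioi δ))
    (η₁ η₂ q : ℝ) (c : ℝ) (hc : c = ∫ y, exp (-η₂ * y) ∂G)
    (hcint : Integrable (fun y => exp (-η₂ * y)) G)
    (N : ℝ → ℝ → ℝ → ℝ)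
    (hN : N = fun s x y =>
      exp (-η₁) * ((cp (κ * s) G) {z | z < q - x - y}).toReal +
      exp (-η₂ * (x + y - q)) *
        ∫ z, exp (-η₂ * z) * (if q - x - y ≤ z then (1:ℝ) else 0) ∂(cp (κ * s) G))
    (H : ℝ → ℝ → ℝ → ℝ) (hH : H = fun s x y => N s x y / N s x 0)
    (κstar : ℝ → ℝ → ℝ) (hκstar : κstar = fun s x => κ * ∫ y, H s x y ∂G) :
    (∀ x > q, ∀ s > (0:ℝ), κstar s x = κ * c) ∧
    (∀ x < q,
      Filter.Tendsto (fun s => κstar s x) (𝓝[>] (0:ℝ))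
        (𝓝 (κ * ((G {y | y < q - x}).toReal +
          exp (η₁ - η₂ * (x - q)) *
            ∫ y, exp (-η₂ * y) * (if q - x ≤ y then (1:ℝ) else 0) ∂G)))) := by
  have hpos : ∀ᵐ y ∂G, 0 < y := by
    rw [ae_iff]; simpa [Set.Iic] using hG
  subst hκstar hH
  dsimp only
  refine ⟨fun x hx s hs => ?_, fun x hx => ?_⟩
  · have hl : 0 ≤ κ * s := by positivity
    have hval : ∀ y, 0 ≤ y →
        N s x y = exp (-η₂ * (x + y - q)) * exp (κ * s * (c - 1)) := by
      intro y hy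
      have hb : q - x - y ≤ 0 := by linarith
      rw [hN]
      dsimp only
      rw [cp_Iio_of_nonpos G hG _ hb, integral_exp_truncated_cp_of_nonpos G η₂ hG hcint hl hb,
        ← hc, mul_zero, zero_add]
    congr 1
    rw [hc]
    refine integral_congr_ae ?_
    filter_upwards [hpos] with y hy
    rw [hval y hy.le, hval 0 le_rfl, mul_div_mul_right _ _ (exp_pos _).ne', ← exp_sub]
    congr 1
    ring
  · have hκs : Tendsto (fun s => κ * s) (𝓝[>] (0 : ℝ)) (𝓝[≥] (0 : ℝ)) := by
      refine tendsto_nhdsWithin_iff.2 ⟨tendsto_mul_const_nhdsGT_zero κ, ?_⟩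
      filter_upwards [self_mem_nhdsWithin] with s (hs : 0 < s)
      exact (mul_pos hκ hs).le
    have hNlim : ∀ y, Tendsto (fun s => N s x y) (𝓝[>] (0 : ℝ))
        (𝓝 (exp (-η₁) * (if 0 < q - x - y then 1 else 0) +
          exp (-η₂ * (x + y - q)) * (if 0 < q - x - y then 0 else 1))) := by
      intro y
      rw [hN]
      exact (((tendsto_cp_Iio G hG _).comp hκs).const_mul _).add
        (((tendsto_integral_exp_truncated_cp G η₂ hG hcint _).comp hκs).const_mul _)
    have hN0 : Tendsto (fun s => N s x 0) (𝓝[>] (0 : ℝ)) (𝓝 (exp (-η₁))) := by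
      have h : 0 < q - x - 0 := by linarith
      simpa only [if_pos h, mul_one, mul_zero, add_zero] using hNlim 0
    have hmeas : ∀ s, 0 < s → Measurable fun y => N s x y := by
      intro s hs
      have hl : 0 ≤ κ * s := by positivity
      have := isProbabilityMeasure_cp G hl
      have h1 : Monotone fun b => ((cp (κ * s) G) {z | z < b}).toReal := fun b b' hb =>
        ENNReal.toReal_mono (measure_ne_top _ _) (measure_mono fun z hz => lt_of_lt_of_le hz hb)
      have hsub : Measurable fun y : ℝ => q - x - y := by fun_prop
      rw [hN]
      exact ((h1.measurable.comp hsub).const_mul _).add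
        ((by fun_prop : Measurable fun y : ℝ => exp (-η₂ * (x + y - q))).mul
          ((integral_exp_truncated_cp_antitone G η₂ hcint hl).measurable.comp hsub))
    have hlow : ∀ᶠ s in 𝓝[>] (0 : ℝ), exp (-η₁) / 2 < N s x 0 :=
      hN0.eventually (lt_mem_nhds (half_lt_self (exp_pos _)))
    have hup : ∀ᶠ s in 𝓝[>] (0 : ℝ), exp (κ * s * (c - 1)) < 2 :=
      ((tendsto_exp_mul_nhds_zero (c - 1)).comp (tendsto_mul_const_nhdsGT_zero κ)).eventually
        (gt_mem_nhds one_lt_two)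
    have hlim : Tendsto (fun s => ∫ y, N s x y / N s x 0 ∂G) (𝓝[>] (0 : ℝ))
        (𝓝 (∫ y, (exp (-η₁) * (if 0 < q - x - y then 1 else 0) +
          exp (-η₂ * (x + y - q)) * (if 0 < q - x - y then 0 else 1)) / exp (-η₁) ∂G)) := by
      refine tendsto_integral_filter_of_dominated_convergence
        (fun y => (exp (-η₁) + exp (-η₂ * (x - q)) * exp (-η₂ * y) * 2) / (exp (-η₁) / 2))
        ?_ ?_ ?_ ?_
      · filter_upwards [self_mem_nhdsWithin] with s hs
        exact ((hmeas s hs).div_const _).aestronglyMeasurable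
      · filter_upwards [self_mem_nhdsWithin, hlow, hup] with s (hs : 0 < s) hs1 hs2
        refine ae_of_all _ fun y => ?_
        have hl : 0 ≤ κ * s := by positivity
        have := isProbabilityMeasure_cp G hl
        have hI0 := integral_exp_truncated_cp_nonneg G η₂ (κ * s) (q - x - y)
        have hI1 := integral_exp_truncated_cp_le G η₂ hcint hl (q - x - y)
        rw [← hc] at hI1
        have hP : ((cp (κ * s) G) {z | z < q - x - y}).toReal ≤ 1 :=
          ENNReal.toReal_le_of_le_ofReal zero_le_one (by simpa using prob_le_one)
        have hexp : exp (-η₂ * (x + y - q)) = exp (-η₂ * (x - q)) * exp (-η₂ * y) := by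
          rw [← exp_add]; congr 1; ring
        have hNy0 : 0 ≤ N s x y := by rw [hN]; dsimp only; positivity
        have hNy1 : N s x y ≤ exp (-η₁) + exp (-η₂ * (x - q)) * exp (-η₂ * y) * 2 := by
          rw [hN, ← hexp]
          dsimp only
          exact add_le_add (mul_le_of_le_one_right (exp_pos _).le hP)
            (mul_le_mul_of_nonneg_left (hI1.trans hs2.le) (exp_pos _).le)
        have hpos0 : 0 < exp (-η₁) / 2 := by positivity
        rw [Real.norm_of_nonneg (div_nonneg hNy0 (hpos0.trans hs1).le)]
        exact div_le_div₀ (hNy0.trans hNy1) hNy1 hpos0 hs1.le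
      · exact ((integrable_const _).add ((hcint.const_mul _).mul_const _)).div_const _
      · exact ae_of_all _ fun y => (hNlim y).div hN0 (exp_pos _).ne'
    have hind : Integrable ({y | y < q - x}.indicator (1 : ℝ → ℝ)) G :=
      (integrable_const (1 : ℝ)).indicator measurableSet_Iio
    have htr : Integrable (fun y => exp (-η₂ * y) * (if q - x ≤ y then (1 : ℝ) else 0)) G := by
      refine hcint.mono' ?_ (ae_of_all _ fun z => ?_)
      · exact ((by fun_prop : Measurable fun z : ℝ => exp (-η₂ * z)).mul
          (Measurable.ite measurableSet_Ici measurable_const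
            measurable_const)).aestronglyMeasurable
      · split_ifs <;> simp [(exp_pos _).le]
    have hval : ∫ y, (exp (-η₁) * (if 0 < q - x - y then 1 else 0) +
          exp (-η₂ * (x + y - q)) * (if 0 < q - x - y then 0 else 1)) / exp (-η₁) ∂G =
        (G {y | y < q - x}).toReal + exp (η₁ - η₂ * (x - q)) *
            ∫ y, exp (-η₂ * y) * (if q - x ≤ y then (1:ℝ) else 0) ∂G := by
      have h1 : ∫ y, {y | y < q - x}.indicator (1 : ℝ → ℝ) y ∂G = (G {y | y < q - x}).toReal :=
        integral_indicator_one measurableSet_Iio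
      rw [← h1, ← integral_const_mul, ← integral_add hind (htr.const_mul _)]
      congr 1
      ext y
      by_cases hy : y < q - x
      · simp [hy, hy.not_ge, Set.indicator]
      · have hy' : q - x ≤ y := not_lt.1 hy
        simp only [sub_pos, hy, hy', Set.indicator, Set.mem_ofPred_eq, if_false, if_true, mul_zero,
          mul_one, zero_add]
        rw [← exp_sub, ← exp_add]
        congr 1
        ring
    rw [hval] at hlim
    exact hlim.const_mul κ
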